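/- arXiv:1005.0207 — 3 statements merged into one kernel-verified Lean document; each statement's English description precedes it below -/
import Mathlib

section
/- Let v ≥ 0, D ≥ 0, let T > 0, K ∈ ℕ with K ≥ 1 and Δt := T/K, and let Δa, Δx > 0 satisfy the CFL condition v·Δt/Δa + 2D·Δt/(Δx)² ≤ 1; set λ := v·Δt/Δa, μ := D·Δt/(Δx)². Suppose w, ψ : ℕ × ℤ × ℤ → ℝ satisfy the recursion w(k+1,i,j) = (1 − λ − 2μ)·w(k,i,j) + λ·w(k,i−1,j) + μ·(w(k,i,j+1) + w(k,i,j−1)) + ψ(k,i,j)·Δt for all k, i, j, together with w(0,i,j) = 0 for all (i,j) and |ψ(k,i,j)| ≤ ε for all k, i, j. Then for every m ∈ ℕ with m ≤ K and all (i,j) ∈ ℤ², |w(m,i,j)| ≤ ε·T. -/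
/-- Global error estimate on the time interval `[0, T]`: with zero initial error,
truncation error bounded by `ε`, and `Δt = T/K`, the error after `m ≤ K` steps
is bounded by `ε·T`. -/
theorem global_error_estimate
    (v D : ℝ) (hv : 0 ≤ v) (hD : 0 ≤ D)
    (T : ℝ) (hT : 0 < T) (K : ℕ) (hK : 1 ≤ K)
    (Δa Δx : ℝ) (hΔa : 0 < Δa) (hΔx : 0 < Δx)
    (hCFL : v * (T / K) / Δa + 2 * D * (T / K) / Δx ^ 2 ≤ 1)
    (w ψ : ℕ → ℤ → ℤ → ℝ)
    (hrec : ∀ (k : ℕ) (i j : ℤ),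
      w (k + 1) i j
        = (1 - v * (T / K) / Δa - 2 * (D * (T / K) / Δx ^ 2)) * w k i j
          + (v * (T / K) / Δa) * w k (i - 1) j
          + (D * (T / K) / Δx ^ 2) * (w k i (j + 1) + w k i (j - 1))
          + ψ k i j * (T / K))
    (hinit : ∀ i j : ℤ, w 0 i j = 0)
    (ε : ℝ)
    (hψ : ∀ (k : ℕ) (i j : ℤ), |ψ k i j| ≤ ε) :
    ∀ (m : ℕ), m ≤ K → ∀ i j : ℤ, |w m i j| ≤ ε * T := by
  have hKpos : (0 : ℝ) < K := by exact_mod_cast hK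
  have hε : 0 ≤ ε := le_trans (abs_nonneg _) (hψ 0 0 0)
  have hdt : 0 < T / K := div_pos hT hKpos
  have hTK : (K : ℝ) * (T / K) = T := by field_simp
  have hl : 0 ≤ v * (T / K) / Δa := by positivity
  have hm : 0 ≤ D * (T / K) / Δx ^ 2 := by positivity
  have hc : 0 ≤ 1 - v * (T / K) / Δa - 2 * (D * (T / K) / Δx ^ 2) := by
    have h : 2 * D * (T / K) / Δx ^ 2 = 2 * (D * (T / K) / Δx ^ 2) := by ring
    linarith
  generalize v * (T / K) / Δa = l at *
  generalize D * (T / K) / Δx ^ 2 = μ at *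
  generalize T / K = d at *
  have key : ∀ (m : ℕ) (i j : ℤ), |w m i j| ≤ ε * (m * d) := by
    intro m
    induction m with
    | zero => intro i j; simp [hinit]
    | succ k ih =>
      intro i j
      have h1 := mul_le_mul_of_nonneg_left (ih i j) hc
      have h2 := mul_le_mul_of_nonneg_left (ih (i - 1) j) hl
      have h3 := mul_le_mul_of_nonneg_left (ih i (j + 1)) hm
      have h4 := mul_le_mul_of_nonneg_left (ih i (j - 1)) hm
      have h5 := mul_le_mul_of_nonneg_right (hψ k i j) hdt.le
      rw [← abs_of_nonneg hc, ← abs_mul, abs_of_nonneg hc] at h1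
      rw [← abs_of_nonneg hl, ← abs_mul, abs_of_nonneg hl] at h2
      rw [← abs_of_nonneg hm, ← abs_mul, abs_of_nonneg hm] at h3 h4
      rw [← abs_of_nonneg hdt.le, ← abs_mul, abs_of_nonneg hdt.le] at h5
      rw [abs_le] at h1 h2 h3 h4 h5
      rw [hrec, abs_le]
      push_cast
      constructor <;> linarith [h1.1, h1.2, h2.1, h2.2, h3.1, h3.2, h4.1, h4.2, h5.1, h5.2]
  intro m hmK i j
  have hmK' : (m : ℝ) ≤ K := by exact_mod_cast hmK
  calc |w m i j| ≤ ε * (m * d) := key m i j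
    _ ≤ ε * (K * d) := by gcongr
    _ = ε * T := by rw [hTK]
end

section
/- Let v ≥ 0, D ≥ 0 be constants and let n : ℝ × ℝ × ℝ → ℝ be a four times continuously differentiable classical solution of ∂n/∂t + v ∂n/∂a = D ∂²n/∂x² on ℝ³ with |∂²n/∂t²| ≤ M_t, |∂²n/∂a²| ≤ M_a and |∂⁴n/∂x⁴| ≤ M_x everywhere. Let T > 0, K ∈ ℕ with K ≥ 1, Δt := T/K, and let Δa, Δx > 0 satisfy the CFL condition v·Δt/Δa + 2D·Δt/(Δx)² ≤ 1. Define the discrete solution u : ℕ × ℤ × ℤ → ℝ by u(0,i,j) := n(0, i·Δa, j·Δx) and u(k+1,i,j) := u(k,i,j) − (v·Δt/Δa)·(u(k,i,j) − u(k,i−1,j)) + (D·Δt/(Δx)²)·(u(k,i,j+1) − 2u(k,i,j) + u(k,i,j−1)). Then for all k ∈ ℕ with k ≤ K and all (i,j) ∈ ℤ², |n(k·Δt, i·Δa, j·Δx) − u(k,i,j)| ≤ T·((M_t/2)·Δt + (v·M_a/2)·Δa + (D·M_x/12)·(Δx)²). -/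
theorem taylor_abs {f : ℝ → ℝ} {m : ℕ} (hf : ContDiff ℝ (m + 1 : ℕ) f) {M : ℝ}
    (hM : ∀ x, |iteratedDeriv (m + 1) f x| ≤ M) (x₀ h : ℝ) (hh : h ≠ 0) :
    |f (x₀ + h) - ∑ k ∈ Finset.range (m + 1), iteratedDeriv k f x₀ * h ^ k / (k.factorial : ℝ)|
      ≤ M * |h| ^ (m + 1) / ((m + 1).factorial : ℝ) := by
  have hne : x₀ ≠ x₀ + h := by intro h'; apply hh; linarith
  obtain ⟨y, -, hy⟩ := taylor_mean_remainder_lagrange_iteratedDeriv (n := m) hne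
    (by exact_mod_cast hf.contDiffOn)
  have hs : taylorWithinEval f m (Set.uIcc x₀ (x₀ + h)) x₀ (x₀ + h)
      = ∑ k ∈ Finset.range (m + 1), iteratedDeriv k f x₀ * h ^ k / (k.factorial : ℝ) := by
    rw [taylor_within_apply]
    refine Finset.sum_congr rfl fun k hk => ?_
    rw [iteratedDerivWithin_eq_iteratedDeriv (uniqueDiffOn_uIcc hne) _ Set.left_mem_uIcc]
    · simp only [smul_eq_mul, add_sub_cancel_left]; field_simp
    · refine (hf.of_le ?_).contDiffAt
      have := Finset.mem_range.1 hk
      exact_mod_cast this.le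
  rw [hs] at hy
  rw [hy, add_sub_cancel_left, abs_div, abs_mul, abs_pow, Nat.abs_cast]
  gcongr
  exact hM y

theorem fwd {f : ℝ → ℝ} (hf : ContDiff ℝ 4 f) {M : ℝ}
    (hM : ∀ x, |iteratedDeriv 2 f x| ≤ M) (x₀ h : ℝ) (hh : h ≠ 0) :
    |f (x₀ + h) - f x₀ - deriv f x₀ * h| ≤ M * h ^ 2 / 2 := by
  have := taylor_abs (m := 1) (hf.of_le (by norm_num)) hM x₀ h hh
  simp [Finset.sum_range_succ, iteratedDeriv_one, Nat.factorial] at this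
  rwa [sub_sub]

theorem cen {f : ℝ → ℝ} (hf : ContDiff ℝ 4 f) {M : ℝ}
    (hM : ∀ x, |iteratedDeriv 4 f x| ≤ M) (x₀ h : ℝ) (hh : h ≠ 0) :
    |f (x₀ + h) - 2 * f x₀ + f (x₀ - h) - iteratedDeriv 2 f x₀ * h ^ 2| ≤ M * h ^ 4 / 12 := by
  have h1 := taylor_abs (m := 3) (hf.of_le (by norm_num)) hM x₀ h hh
  have h2 := taylor_abs (m := 3) (hf.of_le (by norm_num)) hM x₀ (-h) (neg_ne_zero.2 hh)
  have h4 : |h| ^ 4 = h ^ 4 := by rw [← abs_pow, abs_of_nonneg (by positivity)]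
  rw [abs_neg] at h2
  simp only [Finset.sum_range_succ, Finset.sum_range_zero, Nat.factorial, Nat.reduceAdd, h4,
    ← sub_eq_add_neg, iteratedDeriv_zero] at h1 h2
  push_cast at h1 h2
  rw [abs_le] at *
  constructor <;> linarith [h1.1, h1.2, h2.1, h2.2]

/-- Convergence estimate for the explicit upwind/centered scheme: the discrete solution,
initialized with the exact initial data, approximates the exact classical solution of
∂n/∂t + v ∂n/∂a = D ∂²n/∂x² on the mesh up to time `T` with error
`T·((Mt/2)·Δt + (v·Ma/2)·Δa + (D·Mx/12)·Δx²)`. -/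
theorem scheme_error_bound
    (v D : ℝ) (hv : 0 ≤ v) (hD : 0 ≤ D)
    (n : ℝ → ℝ → ℝ → ℝ)
    (hn : ContDiff ℝ 4 (fun p : ℝ × ℝ × ℝ => n p.1 p.2.1 p.2.2))
    (hpde : ∀ t a x : ℝ,
      deriv (fun s => n s a x) t + v * deriv (fun b => n t b x) a
        = D * iteratedDeriv 2 (fun y => n t a y) x)
    (Mt Ma Mx : ℝ)
    (hMt : ∀ t a x : ℝ, |iteratedDeriv 2 (fun s => n s a x) t| ≤ Mt)
    (hMa : ∀ t a x : ℝ, |iteratedDeriv 2 (fun b => n t b x) a| ≤ Ma)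
    (hMx : ∀ t a x : ℝ, |iteratedDeriv 4 (fun y => n t a y) x| ≤ Mx)
    (T : ℝ) (hT : 0 < T) (K : ℕ) (hK : 1 ≤ K)
    (Δa Δx : ℝ) (hΔa : 0 < Δa) (hΔx : 0 < Δx)
    (hCFL : v * (T / K) / Δa + 2 * D * (T / K) / Δx ^ 2 ≤ 1)
    (u : ℕ → ℤ → ℤ → ℝ)
    (hinit : ∀ i j : ℤ, u 0 i j = n 0 (i * Δa) (j * Δx))
    (hrec : ∀ (k : ℕ) (i j : ℤ),
      u (k + 1) i j
        = u k i j - (v * (T / K) / Δa) * (u k i j - u k (i - 1) j)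
          + (D * (T / K) / Δx ^ 2) * (u k i (j + 1) - 2 * u k i j + u k i (j - 1))) :
    ∀ (k : ℕ), k ≤ K → ∀ i j : ℤ,
      |n (k * (T / K)) (i * Δa) (j * Δx) - u k i j|
        ≤ T * ((Mt / 2) * (T / K) + (v * Ma / 2) * Δa + (D * Mx / 12) * Δx ^ 2) := by
  have hKpos : (0 : ℝ) < K := by exact_mod_cast hK
  have hdt : 0 < T / K := div_pos hT hKpos
  have hTK : (K : ℝ) * (T / K) = T := by field_simp
  generalize T / (K : ℝ) = dt at *
  set τ := (Mt / 2) * dt + (v * Ma / 2) * Δa + (D * Mx / 12) * Δx ^ 2 with hτ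
  have hMt0 : 0 ≤ Mt := (abs_nonneg _).trans (hMt 0 0 0)
  have hMa0 : 0 ≤ Ma := (abs_nonneg _).trans (hMa 0 0 0)
  have hMx0 : 0 ≤ Mx := (abs_nonneg _).trans (hMx 0 0 0)
  have hτ0 : 0 ≤ τ := by positivity
  set c := v * dt / Δa with hc
  set d := D * dt / Δx ^ 2 with hd
  have hc0 : 0 ≤ c := by positivity
  have hd0 : 0 ≤ d := by positivity
  have hcd : c + 2 * d ≤ 1 := by
    have : 2 * D * dt / Δx ^ 2 = 2 * d := by rw [hd]; ring
    linarith
  -- consistency of the scheme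
  have hcons : ∀ t a x : ℝ,
      |n (t + dt) a x - (n t a x - c * (n t a x - n t (a - Δa) x)
        + d * (n t a (x + Δx) - 2 * n t a x + n t a (x - Δx)))| ≤ dt * τ := by
    intro t a x
    have ct : ContDiff ℝ 4 (fun s => n s a x) :=
      hn.comp (f := fun s : ℝ => (s, a, x)) (by fun_prop)
    have ca : ContDiff ℝ 4 (fun b => n t b x) :=
      hn.comp (f := fun s : ℝ => (t, s, x)) (by fun_prop)
    have cx : ContDiff ℝ 4 (fun y => n t a y) :=
      hn.comp (f := fun s : ℝ => (t, a, s)) (by fun_prop)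
    have e1 := fwd ct (fun s => hMt s a x) t dt hdt.ne'
    have e2 := fwd ca (fun s => hMa t s x) a (-Δa) (neg_ne_zero.2 hΔa.ne')
    have e3 := cen cx (fun s => hMx t a s) x Δx hΔx.ne'
    have p := hpde t a x
    simp only [← sub_eq_add_neg] at e2
    set P := deriv (fun s => n s a x) t
    set Q := deriv (fun b => n t b x) a
    set R := iteratedDeriv 2 (fun y => n t a y) x
    have e2' := mul_le_mul_of_nonneg_left e2 hc0
    have e3' := mul_le_mul_of_nonneg_left e3 hd0
    have hca : c * Δa = v * dt := by rw [hc]; field_simp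
    have hdx : d * Δx ^ 2 = D * dt := by rw [hd]; field_simp
    rw [← abs_of_nonneg hc0, ← abs_mul, abs_of_nonneg hc0] at e2'
    rw [← abs_of_nonneg hd0, ← abs_mul, abs_of_nonneg hd0] at e3'
    have key : n (t + dt) a x - (n t a x - c * (n t a x - n t (a - Δa) x)
        + d * (n t a (x + Δx) - 2 * n t a x + n t a (x - Δx)))
        = (n (t + dt) a x - n t a x - P * dt)
          - c * (n t (a - Δa) x - n t a x - Q * (-Δa))
          - d * (n t a (x + Δx) - 2 * n t a x + n t a (x - Δx) - R * Δx ^ 2) := by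
      linear_combination dt * p + Q * hca - R * hdx
    have hr : dt * τ = Mt * dt ^ 2 / 2 + c * (Ma * (-Δa) ^ 2 / 2) + d * (Mx * Δx ^ 4 / 12) := by
      rw [hτ]
      linear_combination (-(Ma * Δa / 2)) * hca - (Mx * Δx ^ 2 / 12) * hdx
    rw [key, hr]
    exact (abs_sub _ _).trans (add_le_add ((abs_sub _ _).trans (add_le_add e1 e2')) e3')
  have main : ∀ (k : ℕ) (i j : ℤ),
      |n (k * dt) (i * Δa) (j * Δx) - u k i j| ≤ k * (dt * τ) := by
    intro k
    induction k with
    | zero => intro i j; simp [hinit]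
    | succ k ih =>
      intro i j
      have h0 := hcons (k * dt) (i * Δa) (j * Δx)
      have a1 := ih i j
      have a2 := ih (i - 1) j
      have a3 := ih i (j + 1)
      have a4 := ih i (j - 1)
      push_cast at a1 a2 a3 a4 ⊢
      rw [hrec]
      rw [show ((k : ℝ) + 1) * dt = k * dt + dt by ring]
      rw [show ((i : ℝ) - 1) * Δa = i * Δa - Δa by ring] at a2
      rw [show ((j : ℝ) + 1) * Δx = j * Δx + Δx by ring] at a3
      rw [show ((j : ℝ) - 1) * Δx = j * Δx - Δx by ring] at a4
      have h1 : 0 ≤ 1 - c - 2 * d := by linarith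
      rw [abs_le] at *
      constructor
      · linarith [mul_le_mul_of_nonneg_left a1.1 h1, mul_le_mul_of_nonneg_left a2.1 hc0,
          mul_le_mul_of_nonneg_left a3.1 hd0, mul_le_mul_of_nonneg_left a4.1 hd0, h0.1]
      · linarith [mul_le_mul_of_nonneg_left a1.2 h1, mul_le_mul_of_nonneg_left a2.2 hc0,
          mul_le_mul_of_nonneg_left a3.2 hd0, mul_le_mul_of_nonneg_left a4.2 hd0, h0.2]
  intro k hk i j
  refine (main k i j).trans ?_
  have hk' : (k : ℝ) ≤ K := by exact_mod_cast hk
  calc (k : ℝ) * (dt * τ) ≤ K * (dt * τ) := by gcongr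
    _ = T * τ := by rw [← mul_assoc, hTK]
end

section
/- Let v ≥ 0, D ≥ 0 be constants and let n : ℝ × ℝ × ℝ → ℝ be a four times continuously differentiable classical solution of ∂n/∂t + v ∂n/∂a = D ∂²n/∂x² on ℝ³ with bounded ∂²n/∂t², ∂²n/∂a² and ∂⁴n/∂x⁴, and fix T > 0. For each m ∈ ℕ let K_m ≥ 1 be an integer, Δt_m := T/K_m, and let Δa_m, Δx_m > 0 satisfy the CFL condition v·Δt_m/Δa_m + 2D·Δt_m/(Δx_m)² ≤ 1; let u_m be the corresponding discrete solution defined by u_m(0,i,j) := n(0, i·Δa_m, j·Δx_m) and the scheme u_m(k+1,i,j) := u_m(k,i,j) − (v·Δt_m/Δa_m)·(u_m(k,i,j) − u_m(k,i−1,j)) + (D·Δt_m/(Δx_m)²)·(u_m(k,i,j+1) − 2u_m(k,i,j) + u_m(k,i,j−1)). If Δt_m → 0, Δa_m → 0 and Δx_m → 0 as m → ∞, then sup_{0 ≤ k ≤ K_m, (i,j) ∈ ℤ²} |n(k·Δt_m, i·Δa_m, j·Δx_m) − u_m(k,i,j)| → 0 as m → ∞, i.e. the approximate solutions converge uniformly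 on the mesh points to the exact solution. -/
lemma taylor_two (f : ℝ → ℝ) (hf : ContDiff ℝ 2 f) (M : ℝ)
    (hM : ∀ y, |iteratedDeriv 2 f y| ≤ M) (x h : ℝ) (hh : h ≠ 0) :
    |f (x + h) - f x - h * deriv f x| ≤ M * h ^ 2 := by
  have hx : x ≠ x + h := by simpa using hh
  have hu := uniqueDiffOn_uIcc hx
  obtain ⟨y, -, hy⟩ := taylor_mean_remainder_lagrange_iteratedDeriv (n := 1) hx
    (f := f) (by norm_num; exact hf.contDiffOn)
  have hxm : x ∈ Set.uIcc x (x + h) := Set.left_mem_uIcc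
  rw [taylorWithinEval_succ, taylor_within_zero_eval,
    iteratedDerivWithin_eq_iteratedDeriv hu ((hf.of_le (by norm_num)).contDiffAt) hxm] at hy
  simp [iteratedDeriv_one, Nat.factorial] at hy
  have e : f (x + h) - f x - h * deriv f x = iteratedDeriv 2 f y * h ^ 2 / 2 := by linarith
  rw [e, abs_div, abs_mul, abs_of_nonneg (sq_nonneg h), abs_two]
  have := hM y
  have h2 := mul_le_mul_of_nonneg_right this (sq_nonneg h)
  have h3 : 0 ≤ |iteratedDeriv 2 f y| * h ^ 2 := by positivity
  linarith

lemma taylor_four_one (f : ℝ → ℝ) (hf : ContDiff ℝ 4 f) (M : ℝ)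
    (hM : ∀ y, |iteratedDeriv 4 f y| ≤ M) (x h : ℝ) (hh : h ≠ 0) :
    |f (x + h) - f x - h * deriv f x - h ^ 2 / 2 * iteratedDeriv 2 f x
      - h ^ 3 / 6 * iteratedDeriv 3 f x| ≤ M * h ^ 4 / 24 := by
  have hx : x ≠ x + h := by simpa using hh
  have hu := uniqueDiffOn_uIcc hx
  obtain ⟨y, -, hy⟩ := taylor_mean_remainder_lagrange_iteratedDeriv (n := 3) hx
    (f := f) (by norm_num; exact hf.contDiffOn)
  have hxm : x ∈ Set.uIcc x (x + h) := Set.left_mem_uIcc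
  rw [taylorWithinEval_succ, taylorWithinEval_succ, taylorWithinEval_succ, taylor_within_zero_eval,
    iteratedDerivWithin_eq_iteratedDeriv hu ((hf.of_le (by norm_num)).contDiffAt) hxm,
    iteratedDerivWithin_eq_iteratedDeriv hu ((hf.of_le (by norm_num)).contDiffAt) hxm,
    iteratedDerivWithin_eq_iteratedDeriv hu ((hf.of_le (by norm_num)).contDiffAt) hxm] at hy
  simp [iteratedDeriv_one, Nat.factorial] at hy
  have e : f (x + h) - f x - h * deriv f x - h ^ 2 / 2 * iteratedDeriv 2 f x
      - h ^ 3 / 6 * iteratedDeriv 3 f x = iteratedDeriv 4 f y * h ^ 4 / 24 := by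
    norm_num at hy
    linarith
  have h4 : 0 ≤ h ^ 4 := by positivity
  rw [e, abs_div, abs_mul, abs_of_nonneg h4, abs_of_pos (by norm_num : (0:ℝ) < 24)]
  have h2 := mul_le_mul_of_nonneg_right (hM y) h4
  linarith

lemma taylor_four (f : ℝ → ℝ) (hf : ContDiff ℝ 4 f) (M : ℝ)
    (hM : ∀ y, |iteratedDeriv 4 f y| ≤ M) (x h : ℝ) (hh : h ≠ 0) :
    |f (x + h) - 2 * f x + f (x - h) - h ^ 2 * iteratedDeriv 2 f x| ≤ M * h ^ 4 := by
  have h1 := abs_le.1 (taylor_four_one f hf M hM x h hh)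
  have h2 := abs_le.1 (taylor_four_one f hf M hM x (-h) (neg_ne_zero.2 hh))
  rw [← sub_eq_add_neg] at h2
  have h4 : 0 ≤ M * h ^ 4 := mul_nonneg ((abs_nonneg _).trans (hM 0)) (by positivity)
  rw [abs_le]
  constructor <;> nlinarith

lemma truncation
    (v D : ℝ) (hv : 0 ≤ v) (hD : 0 ≤ D)
    (n : ℝ → ℝ → ℝ → ℝ)
    (hn : ContDiff ℝ 4 (fun p : ℝ × ℝ × ℝ => n p.1 p.2.1 p.2.2))
    (hpde : ∀ t a x : ℝ,
      deriv (fun s => n s a x) t + v * deriv (fun b => n t b x) a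
        = D * iteratedDeriv 2 (fun y => n t a y) x)
    (Mt Ma Mx : ℝ)
    (hMt : ∀ t a x : ℝ, |iteratedDeriv 2 (fun s => n s a x) t| ≤ Mt)
    (hMa : ∀ t a x : ℝ, |iteratedDeriv 2 (fun b => n t b x) a| ≤ Ma)
    (hMx : ∀ t a x : ℝ, |iteratedDeriv 4 (fun y => n t a y) x| ≤ Mx)
    (dt da dx : ℝ) (hdt : 0 < dt) (hda : 0 < da) (hdx : 0 < dx) (t a x : ℝ) :
    |n (t + dt) a x - (n t a x - (v * dt / da) * (n t a x - n t (a - da) x)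
      + (D * dt / dx ^ 2) * (n t a (x + dx) - 2 * n t a x + n t a (x - dx)))|
      ≤ dt * (Mt * dt + v * Ma * da + D * Mx * dx ^ 2) := by
  have ct : ContDiff ℝ 4 (fun s => n s a x) :=
    hn.comp (by fun_prop : ContDiff ℝ 4 (fun s : ℝ => ((s, a, x) : ℝ × ℝ × ℝ)))
  have ca : ContDiff ℝ 4 (fun b => n t b x) :=
    hn.comp (by fun_prop : ContDiff ℝ 4 (fun b : ℝ => ((t, b, x) : ℝ × ℝ × ℝ)))
  have cx : ContDiff ℝ 4 (fun y => n t a y) :=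
    hn.comp (by fun_prop : ContDiff ℝ 4 (fun y : ℝ => ((t, a, y) : ℝ × ℝ × ℝ)))
  have h1 := taylor_two _ (ct.of_le (by norm_num)) Mt (fun s => hMt s a x) t dt hdt.ne'
  have h2 := taylor_two _ (ca.of_le (by norm_num)) Ma (fun s => hMa t s x) a (-da)
    (neg_ne_zero.2 hda.ne')
  have h3 := taylor_four _ cx Mx (fun s => hMx t a s) x dx hdx.ne'
  have hp := hpde t a x
  simp only [← sub_eq_add_neg] at h2
  generalize deriv (fun s => n s a x) t = nt at *
  generalize deriv (fun b => n t b x) a = na at *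
  generalize iteratedDeriv 2 (fun y => n t a y) x = nxx at *
  set A := n (t + dt) a x - n t a x - dt * nt with hA
  set B := n t (a - da) x - n t a x - -da * na with hB
  set C := n t a (x + dx) - 2 * n t a x + n t a (x - dx) - dx ^ 2 * nxx with hC
  have e : n (t + dt) a x - (n t a x - (v * dt / da) * (n t a x - n t (a - da) x)
      + (D * dt / dx ^ 2) * (n t a (x + dx) - 2 * n t a x + n t a (x - dx)))
      = A - (v * dt / da) * B - (D * dt / dx ^ 2) * C := by
    have e1 : n (t + dt) a x = A + n t a x + dt * nt := by rw [hA]; ring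
    have e2 : n t (a - da) x = B + n t a x - da * na := by rw [hB]; ring
    have e3 : n t a (x + dx) - 2 * n t a x + n t a (x - dx) = C + dx ^ 2 * nxx := by rw [hC]; ring
    have e4 : nt = D * nxx - v * na := by linarith
    rw [e1, e2, e3, e4]
    field_simp
    ring
  rw [e]
  have l0 : 0 ≤ v * dt / da := by positivity
  have m0 : 0 ≤ D * dt / dx ^ 2 := by positivity
  have k2 : |(v * dt / da) * B| ≤ dt * (v * Ma * da) := by
    rw [abs_mul, abs_of_nonneg l0]
    calc _ ≤ (v * dt / da) * (Ma * (-da) ^ 2) := mul_le_mul_of_nonneg_left h2 l0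
      _ = _ := by field_simp
  have k3 : |(D * dt / dx ^ 2) * C| ≤ dt * (D * Mx * dx ^ 2) := by
    rw [abs_mul, abs_of_nonneg m0]
    calc _ ≤ (D * dt / dx ^ 2) * (Mx * dx ^ 4) := mul_le_mul_of_nonneg_left h3 m0
      _ = _ := by field_simp
  rw [abs_le] at *
  constructor <;> linarith

lemma stab (l μ e1 e2 e3 e4 τ E δ : ℝ) (hl : 0 ≤ l) (hμ : 0 ≤ μ) (hc : l + 2 * μ ≤ 1)
    (h1 : |e1| ≤ E) (h2 : |e2| ≤ E) (h3 : |e3| ≤ E) (h4 : |e4| ≤ E) (hτ : |τ| ≤ δ) :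
    |e1 - l * (e1 - e2) + μ * (e3 - 2 * e1 + e4) + τ| ≤ E + δ := by
  rw [abs_le] at *
  have hc' : 0 ≤ 1 - l - 2 * μ := by linarith
  constructor
  · have := mul_nonneg hc' (by linarith : 0 ≤ e1 + E)
    have := mul_nonneg hl (by linarith : 0 ≤ e2 + E)
    have := mul_nonneg hμ (by linarith : 0 ≤ e3 + E)
    have := mul_nonneg hμ (by linarith : 0 ≤ e4 + E)
    linarith
  · have := mul_nonneg hc' (by linarith : 0 ≤ E - e1)
    have := mul_nonneg hl (by linarith : 0 ≤ E - e2)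
    have := mul_nonneg hμ (by linarith : 0 ≤ E - e3)
    have := mul_nonneg hμ (by linarith : 0 ≤ E - e4)
    linarith

/-- Convergence of the approximate solutions to the exact solution on the mesh points:
as the mesh steps tend to zero (under the CFL condition), the discrete solutions
converge to the exact solution uniformly on the mesh points. -/
theorem scheme_convergence
    (v D : ℝ) (hv : 0 ≤ v) (hD : 0 ≤ D)
    (n : ℝ → ℝ → ℝ → ℝ)
    (hn : ContDiff ℝ 4 (fun p : ℝ × ℝ × ℝ => n p.1 p.2.1 p.2.2))
    (hpde : ∀ t a x : ℝ,
      deriv (fun s => n s a x) t + v * deriv (fun b => n t b x) a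
        = D * iteratedDeriv 2 (fun y => n t a y) x)
    (Mt Ma Mx : ℝ)
    (hMt : ∀ t a x : ℝ, |iteratedDeriv 2 (fun s => n s a x) t| ≤ Mt)
    (hMa : ∀ t a x : ℝ, |iteratedDeriv 2 (fun b => n t b x) a| ≤ Ma)
    (hMx : ∀ t a x : ℝ, |iteratedDeriv 4 (fun y => n t a y) x| ≤ Mx)
    (T : ℝ) (hT : 0 < T)
    (K : ℕ → ℕ) (hK : ∀ m, 1 ≤ K m)
    (Δa Δx : ℕ → ℝ) (hΔa : ∀ m, 0 < Δa m) (hΔx : ∀ m, 0 < Δx m)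
    (hCFL : ∀ m, v * (T / K m) / Δa m + 2 * D * (T / K m) / (Δx m) ^ 2 ≤ 1)
    (u : ℕ → ℕ → ℤ → ℤ → ℝ)
    (hinit : ∀ (m : ℕ) (i j : ℤ), u m 0 i j = n 0 (i * Δa m) (j * Δx m))
    (hrec : ∀ (m k : ℕ) (i j : ℤ),
      u m (k + 1) i j
        = u m k i j - (v * (T / K m) / Δa m) * (u m k i j - u m k (i - 1) j)
          + (D * (T / K m) / (Δx m) ^ 2)
              * (u m k i (j + 1) - 2 * u m k i j + u m k i (j - 1)))
    (hΔt0 : Filter.Tendsto (fun m => T / (K m : ℝ)) Filter.atTop (nhds 0))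
    (hΔa0 : Filter.Tendsto Δa Filter.atTop (nhds 0))
    (hΔx0 : Filter.Tendsto Δx Filter.atTop (nhds 0)) :
    ∀ ε : ℝ, 0 < ε → ∃ N : ℕ, ∀ m : ℕ, N ≤ m →
      ∀ (k : ℕ), k ≤ K m → ∀ i j : ℤ,
        |n (k * (T / K m)) (i * Δa m) (j * Δx m) - u m k i j| ≤ ε := by
  intro ε hε
  set C : ℕ → ℝ := fun m => Mt * (T / K m) + v * Ma * Δa m + D * Mx * (Δx m) ^ 2 with hC
  have hlim : Filter.Tendsto (fun m => T * C m) Filter.atTop (nhds 0) := by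
    have := (((hΔt0.const_mul Mt).add (hΔa0.const_mul (v * Ma))).add
      ((hΔx0.pow 2).const_mul (D * Mx))).const_mul T
    simpa [hC] using this
  obtain ⟨N, hN⟩ := Filter.eventually_atTop.1 (hlim.eventually (ge_mem_nhds hε))
  refine ⟨N, fun m hm k hk i j => ?_⟩
  have hK0 : (0 : ℝ) < K m := by exact_mod_cast hK m
  have hdt : 0 < T / (K m : ℝ) := by positivity
  have hC0 : 0 ≤ C m := by
    have a1 : 0 ≤ Mt := (abs_nonneg _).trans (hMt 0 0 0)
    have a2 : 0 ≤ Ma := (abs_nonneg _).trans (hMa 0 0 0)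
    have a3 : 0 ≤ Mx := (abs_nonneg _).trans (hMx 0 0 0)
    have := hΔa m
    simp only [hC]
    positivity
  have key : ∀ k : ℕ, ∀ i j : ℤ,
      |n (k * (T / K m)) (i * Δa m) (j * Δx m) - u m k i j| ≤ k * ((T / K m) * C m) := by
    intro k
    induction k with
    | zero => intro i j; simp [hinit]
    | succ k ih =>
      intro i j
      have ht := truncation v D hv hD n hn hpde Mt Ma Mx hMt hMa hMx (T / K m) (Δa m) (Δx m)
        hdt (hΔa m) (hΔx m) (k * (T / K m)) (i * Δa m) (j * Δx m)
      have g1 := ih i j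
      have g2 := ih (i - 1) j
      have g3 := ih i (j + 1)
      have g4 := ih i (j - 1)
      push_cast at g2 g3 g4 ⊢
      rw [sub_mul, one_mul] at g2 g4
      rw [add_mul, one_mul] at g3
      have hs := stab (v * (T / K m) / Δa m) (D * (T / K m) / (Δx m) ^ 2) _ _ _ _ _ _ _
        (by have := hΔa m; positivity) (by positivity)
        (by have := hCFL m; calc _ = _ := by ring
              _ ≤ 1 := this) g1 g2 g3 g4 ht
      rw [hrec, add_mul (k : ℝ) 1 (T / K m), one_mul]
      convert hs using 1
      · congr 1; ring
      · simp only [hC]; ring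
  refine (key k i j).trans (le_trans ?_ (hN m hm))
  have hk' : (k : ℝ) ≤ K m := by exact_mod_cast hk
  calc (k : ℝ) * ((T / K m) * C m) ≤ K m * ((T / K m) * C m) :=
        mul_le_mul_of_nonneg_right hk' (by positivity)
    _ = T * C m := by field_simp
end
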